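/- Let 0 < d < D be integers, let L₁ be a d-flat in ℝ^D, let x ∈ L₁, let 0 < w < r with (r² − w²)(D−d+2) ≥ w²(d+2), and let Ω ⊆ ℝ^D be a measurable set such that Ω ∩ B(x,r) = T(L₁,w) ∩ B(x,r). Define β₂(x,r)² = inf over d-flats L of (1/vol(Ω ∩ B(x,r))) · ∫_{Ω ∩ B(x,r)} (dist(y,L)/(2r))² dy. Then β₂(x,r)² ≥ ((D−d)/(D−d+2)) · (w²/(4r²)) · (1 − w²/r²)^{d/2}. -/

import Mathlib

open MeasureTheory Metric

/-- The tube of width `w` around a set `L`. -/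
def tube {E : Type*} [PseudoMetricSpace E] (L : Set E) (w : ℝ) : Set E :=
  {y | infDist y L ≤ w}

/-- The squared (scaled) least squares `β₂` number of `Ω ∩ B(x,r)`: the infimum over all
`d`-dimensional affine subspaces `L` of `ℝ^D` of the average over `Ω ∩ B(x,r)` of
`(dist(y,L)/(2r))²`, with respect to Lebesgue measure. -/
noncomputable def beta2Sq (d D : ℕ) (Ω : Set (EuclideanSpace ℝ (Fin D)))
    (x : EuclideanSpace ℝ (Fin D)) (r : ℝ) : ℝ :=
  sInf { s : ℝ | ∃ L : AffineSubspace ℝ (EuclideanSpace ℝ (Fin D)),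
    Module.finrank ℝ L.direction = d ∧ (L : Set (EuclideanSpace ℝ (Fin D))).Nonempty ∧
    s = ((volume (Ω ∩ closedBall x r)).toReal)⁻¹ *
      ∫ y in Ω ∩ closedBall x r,
        (infDist y (L : Set (EuclideanSpace ℝ (Fin D))) / (2 * r)) ^ 2 }

open Module (finrank)
open scoped RealInnerProductSpace

section BallMoments

variable {F : Type*} [NormedAddCommGroup F] [InnerProductSpace ℝ F] [FiniteDimensional ℝ F]
  [MeasurableSpace F] [BorelSpace F]

/-- The volume of a ball scales with the power `finrank ℝ F` of its radius. -/
theorem volume_real_closedBall_zero {R : ℝ} (hR : 0 ≤ R) :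
    volume.real (closedBall (0 : F) R) = R ^ finrank ℝ F * volume.real (ball (0 : F) 1) := by
  rw [measureReal_def, Measure.addHaar_closedBall _ _ hR, ENNReal.toReal_mul,
    ENNReal.toReal_ofReal (by positivity), measureReal_def]

/-- The second moment of the norm over a centered ball. -/
theorem setIntegral_closedBall_norm_sq [Nontrivial F] {R : ℝ} (hR : 0 ≤ R) :
    ∫ y in closedBall (0 : F) R, ‖y‖ ^ 2 =
      finrank ℝ F * (R ^ 2 / (finrank ℝ F + 2) * volume.real (closedBall (0 : F) R)) := by
  have hn : 0 < finrank ℝ F := Module.finrank_pos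
  have hball : closedBall (0 : F) R = norm ⁻¹' Set.Iic R := by ext; simp
  have h1 : ∫ y in closedBall (0 : F) R, ‖y‖ ^ 2 =
      ∫ y : F, (Set.Iic R).indicator (fun t : ℝ => t ^ 2) ‖y‖ := by
    rw [← integral_indicator measurableSet_closedBall, hball]
    rfl
  have h2 : ∫ t in Set.Ioi (0 : ℝ),
      t ^ (finrank ℝ F - 1) • (Set.Iic R).indicator (fun t : ℝ => t ^ 2) t =
      R ^ (finrank ℝ F + 2) / (finrank ℝ F + 2) := by
    have : (fun t : ℝ => t ^ (finrank ℝ F - 1) • (Set.Iic R).indicator (fun t : ℝ => t ^ 2) t) =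
        (Set.Iic R).indicator (fun t : ℝ => t ^ (finrank ℝ F + 1)) := by
      ext t
      by_cases ht : t ∈ Set.Iic R
      · simp only [Set.indicator_of_mem ht, smul_eq_mul, ← pow_add]
        congr 1
        omega
      · simp [Set.indicator_of_notMem ht]
    rw [this, setIntegral_indicator measurableSet_Iic, Set.Ioi_inter_Iic,
      ← intervalIntegral.integral_of_le hR, integral_pow]
    push_cast
    simp
    ring
  rw [h1, integral_fun_norm_addHaar volume, h2, volume_real_closedBall_zero hR]
  simp only [nsmul_eq_mul, smul_eq_mul]
  ring

theorem setIntegral_closedBall_inner_sq_eq_of_norm_eq {a b : F} (h : ‖a‖ = ‖b‖) (R : ℝ) :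
    ∫ y in closedBall (0 : F) R, ⟪a, y⟫ ^ 2 = ∫ y in closedBall (0 : F) R, ⟪b, y⟫ ^ 2 := by
  set T := (ℝ ∙ (a - b))ᗮ.reflection
  have hT : T a = b := Submodule.reflection_sub h
  have hpre : T ⁻¹' closedBall (0 : F) R = closedBall (0 : F) R := by ext; simp
  have := T.measurePreserving.setIntegral_preimage_emb
    T.toHomeomorph.measurableEmbedding (fun y => ⟪b, y⟫ ^ 2) (closedBall 0 R)
  rw [hpre] at this
  rw [← this]
  simp [← hT]

/-- The second moments of a centered ball. -/
theorem setIntegral_closedBall_inner_sq (a : F) {R : ℝ} (hR : 0 ≤ R) :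
    ∫ y in closedBall (0 : F) R, ⟪a, y⟫ ^ 2 =
      ‖a‖ ^ 2 * (R ^ 2 / (finrank ℝ F + 2)) * volume.real (closedBall (0 : F) R) := by
  rcases eq_or_ne a 0 with rfl | ha
  · simp
  have : Nontrivial F := ⟨⟨a, 0, ha⟩⟩
  have hn : (0 : ℝ) < finrank ℝ F := by exact_mod_cast Module.finrank_pos
  have hint : ∀ b : F, IntegrableOn (fun y : F => ⟪b, y⟫ ^ 2) (closedBall 0 R) := fun b =>
    (by fun_prop : Continuous fun y : F => ⟪b, y⟫ ^ 2).continuousOn.integrableOn_compact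
      (isCompact_closedBall _ _)
  set e := stdOrthonormalBasis ℝ F
  have key : ∀ i, ∫ y in closedBall (0 : F) R, ⟪a, y⟫ ^ 2 =
      ‖a‖ ^ 2 * ∫ y in closedBall (0 : F) R, ⟪e i, y⟫ ^ 2 := by
    intro i
    rw [setIntegral_closedBall_inner_sq_eq_of_norm_eq (b := ‖a‖ • e i) (by simp [norm_smul]) R,
      ← integral_const_mul]
    simp [inner_smul_left, mul_pow]
  have hsum : finrank ℝ F * ∫ y in closedBall (0 : F) R, ⟪a, y⟫ ^ 2 =
      ‖a‖ ^ 2 * ∫ y in closedBall (0 : F) R, ‖y‖ ^ 2 := by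
    simp_rw [← e.sum_sq_inner_right (_ : F)]
    rw [integral_finsetSum _ fun i _ => hint (e i), e.sum_sq_inner_right, Finset.mul_sum,
      ← Finset.sum_congr rfl fun i _ => key i]
    simp
  rw [setIntegral_closedBall_norm_sq hR] at hsum
  apply mul_left_cancel₀ hn.ne'
  rw [hsum]
  ring

/-- The second moments of a centered ball with respect to an affine functional. -/
theorem setIntegral_closedBall_add_inner_sq (a : F) (c : ℝ) {R : ℝ} (hR : 0 ≤ R) :
    ∫ y in closedBall (0 : F) R, (c + ⟪a, y⟫) ^ 2 =
      (c ^ 2 + ‖a‖ ^ 2 * (R ^ 2 / (finrank ℝ F + 2))) *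
        volume.real (closedBall (0 : F) R) := by
  have hK := isCompact_closedBall (0 : F) R
  have hodd : ∫ y in closedBall (0 : F) R, ⟪a, y⟫ = 0 := by
    have := (Measure.measurePreserving_neg (volume : Measure F)).setIntegral_preimage_emb
      (MeasurableEquiv.neg F).measurableEmbedding (fun y => ⟪a, y⟫) (closedBall 0 R)
    simp only [inner_neg_right, integral_neg, Set.neg_preimage, neg_closedBall, neg_zero] at this
    linarith
  have h1 : IntegrableOn (fun y : F => c ^ 2 + 2 * c * ⟪a, y⟫) (closedBall 0 R) :=
    (by fun_prop : Continuous _).continuousOn.integrableOn_compact hK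
  have h2 : IntegrableOn (fun y : F => ⟪a, y⟫ ^ 2) (closedBall 0 R) :=
    (by fun_prop : Continuous _).continuousOn.integrableOn_compact hK
  have h3 : IntegrableOn (fun y : F => 2 * c * ⟪a, y⟫) (closedBall 0 R) :=
    (by fun_prop : Continuous _).continuousOn.integrableOn_compact hK
  have h4 : IntegrableOn (fun _ : F => c ^ 2) (closedBall 0 R) :=
    continuousOn_const.integrableOn_compact hK
  calc ∫ y in closedBall (0 : F) R, (c + ⟪a, y⟫) ^ 2
      = ∫ y in closedBall (0 : F) R, (c ^ 2 + 2 * c * ⟪a, y⟫ + ⟪a, y⟫ ^ 2) := by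
        congr with y
        ring
    _ = _ := by
        rw [integral_add h1 h2, integral_add h4 h3, integral_const_mul, hodd,
          setIntegral_closedBall_inner_sq a hR, setIntegral_const, smul_eq_mul]
        ring

end BallMoments

section Cylinder

variable {E : Type*} [NormedAddCommGroup E] [InnerProductSpace ℝ E] [FiniteDimensional ℝ E]
  [MeasurableSpace E] [BorelSpace E]

theorem Submodule.volume_preserving_measurableEquivProd (V : Submodule ℝ E) (x : E) :
    MeasurePreserving (V.measurableEquivProd x) := by
  refine (measurePreserving_sub_right volume x).trans ?_
  refine V.orthogonalDecomposition.measurePreserving.trans ?_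
  exact WithLp.volume_preserving_ofLp _ _

/-- The product of a ball of radius `ρ` in `V` and of a ball of radius `w` in `Vᗮ`, centered
at `x`. -/
def orthoCylinder (V : Submodule ℝ E) (x : E) (ρ w : ℝ) : Set E :=
  V.measurableEquivProd x ⁻¹' (closedBall 0 ρ ×ˢ closedBall 0 w)

theorem mem_orthoCylinder {V : Submodule ℝ E} {x y : E} {ρ w : ℝ} :
    y ∈ orthoCylinder V x ρ w ↔ ‖V.orthogonalProjectionOnto (y - x)‖ ≤ ρ ∧
      ‖Vᗮ.orthogonalProjectionOnto (y - x)‖ ≤ w := by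
  simp only [orthoCylinder, Set.mem_preimage, Submodule.measurableEquivProd_apply, vsub_eq_sub,
    Set.mem_prod, mem_closedBall_zero_iff]

theorem isCompact_orthoCylinder (V : Submodule ℝ E) (x : E) (ρ w : ℝ) :
    IsCompact (orthoCylinder V x ρ w) := by
  rw [orthoCylinder, ← MeasurableEquiv.image_symm]
  refine ((isCompact_closedBall _ _).prod (isCompact_closedBall _ _)).image ?_
  have : ⇑(V.measurableEquivProd x).symm = fun q : V × Vᗮ => (q.1 : E) + q.2 + x := by
    ext1 q
    simp
  rw [this]
  fun_prop

theorem volume_real_orthoCylinder (V : Submodule ℝ E) (x : E) (ρ w : ℝ) :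
    volume.real (orthoCylinder V x ρ w) =
      volume.real (closedBall (0 : V) ρ) * volume.real (closedBall (0 : Vᗮ) w) := by
  rw [measureReal_def, orthoCylinder, (V.volume_preserving_measurableEquivProd x).measure_preimage_equiv,
    Measure.volume_eq_prod, Measure.prod_prod, ENNReal.toReal_mul, measureReal_def, measureReal_def]

/-- The second moments of a cylinder with respect to a linear functional centered at `p`. -/
theorem setIntegral_orthoCylinder_inner_sub_sq (V : Submodule ℝ E) (x p g : E) {ρ w : ℝ}
    (hρ : 0 ≤ ρ) (hw : 0 ≤ w) :
    ∫ y in orthoCylinder V x ρ w, ⟪g, y - p⟫ ^ 2 =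
      (⟪g, x - p⟫ ^ 2 + ‖V.orthogonalProjectionOnto g‖ ^ 2 * (ρ ^ 2 / (finrank ℝ V + 2)) +
        ‖Vᗮ.orthogonalProjectionOnto g‖ ^ 2 * (w ^ 2 / (finrank ℝ Vᗮ + 2))) *
        volume.real (orthoCylinder V x ρ w) := by
  have hmp := V.volume_preserving_measurableEquivProd x
  have h := hmp.symm.setIntegral_preimage_emb
    (V.measurableEquivProd x).symm.measurableEmbedding (fun y => ⟪g, y - p⟫ ^ 2)
    (orthoCylinder V x ρ w)
  have hpre : (V.measurableEquivProd x).symm ⁻¹' orthoCylinder V x ρ w =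
      closedBall (0 : V) ρ ×ˢ closedBall (0 : Vᗮ) w := by
    rw [orthoCylinder, ← Set.preimage_comp, MeasurableEquiv.self_comp_symm, Set.preimage_id]
  have hexp : ∀ q : V × Vᗮ, ⟪g, (V.measurableEquivProd x).symm q - p⟫ =
      (⟪g, x - p⟫ + ⟪V.orthogonalProjectionOnto g, q.1⟫) +
        ⟪Vᗮ.orthogonalProjectionOnto g, q.2⟫ := by
    intro q
    rw [Submodule.inner_orthogonalProjectionOnto_eq_of_mem_right,
      Submodule.inner_orthogonalProjectionOnto_eq_of_mem_right,
      Submodule.measurableEquivProd_symm_apply, ← inner_add_right, ← inner_add_right]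
    congr 1
    simp only [vadd_eq_add]
    abel
  have hcont : Continuous fun q : V × Vᗮ =>
      (⟪g, x - p⟫ + ⟪V.orthogonalProjectionOnto g, q.1⟫ +
        ⟪Vᗮ.orthogonalProjectionOnto g, q.2⟫) ^ 2 := by fun_prop
  have hprodset : IsCompact (closedBall (0 : V) ρ ×ˢ closedBall (0 : Vᗮ) w) :=
    (isCompact_closedBall _ _).prod (isCompact_closedBall _ _)
  rw [← h, hpre]
  simp_rw [hexp]
  rw [Measure.volume_eq_prod, setIntegral_prod _ (by
    rw [← Measure.volume_eq_prod]
    exact hcont.continuousOn.integrableOn_compact hprodset)]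
  simp_rw [setIntegral_closedBall_add_inner_sq _ _ hw]
  have h5 : IntegrableOn (fun y : V => (⟪g, x - p⟫ + ⟪V.orthogonalProjectionOnto g, y⟫) ^ 2)
      (closedBall 0 ρ) :=
    (by fun_prop : Continuous _).continuousOn.integrableOn_compact (isCompact_closedBall _ _)
  rw [integral_mul_const, integral_add h5 (continuousOn_const.integrableOn_compact
      (isCompact_closedBall _ _)), setIntegral_closedBall_add_inner_sq _ _ hρ, setIntegral_const,
    smul_eq_mul, volume_real_orthoCylinder]
  ring

end Cylinder

section Flat

variable {E : Type*} [NormedAddCommGroup E] [InnerProductSpace ℝ E] [FiniteDimensional ℝ E]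

theorem AffineSubspace.infDist_eq_norm_orthogonalProjectionOnto (L : AffineSubspace ℝ E)
    {p : E} (hp : p ∈ L) (y : E) :
    infDist y (L : Set E) = ‖L.directionᗮ.orthogonalProjectionOnto (y - p)‖ := by
  have : Nonempty L := ⟨⟨p, hp⟩⟩
  rw [← EuclideanGeometry.dist_orthogonalProjection_eq_infDist, dist_eq_norm]
  set q := EuclideanGeometry.orthogonalProjection L y
  have hq : y - q ∈ L.directionᗮ :=
    EuclideanGeometry.vsub_orthogonalProjection_mem_direction_orthogonal L y
  have hqp : (q : E) - p ∈ L.direction := L.vsub_mem_direction q.2 hp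
  have h1 := Submodule.orthogonalProjectionOnto_mem_subspace_eq_self (⟨y - q, hq⟩ : L.directionᗮ)
  have h2 := Submodule.orthogonalProjectionOnto_orthogonal_apply_eq_zero hqp
  rw [← sub_add_sub_cancel y (q : E) p, map_add, h2, add_zero, h1, Submodule.coe_norm]

theorem AffineSubspace.infDist_sq_eq_sum_inner_sq (L : AffineSubspace ℝ E)
    {p : E} (hp : p ∈ L) {ι : Type*} [Fintype ι] (b : OrthonormalBasis ι ℝ L.directionᗮ) (y : E) :
    infDist y (L : Set E) ^ 2 = ∑ i, ⟪(b i : E), y - p⟫ ^ 2 := by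
  rw [L.infDist_eq_norm_orthogonalProjectionOnto hp, ← b.sum_sq_inner_right]
  simp only [Submodule.inner_orthogonalProjectionOnto_eq_of_mem_left]

/-- If the second moments of a cylinder along `V` dominate those along `Vᗮ`, then the mean square
distance over the cylinder to a flat of dimension `finrank ℝ V` is minimal for the flat `x + V`,
for which it is the left-hand side. -/
theorem le_setIntegral_orthoCylinder_infDist_sq [MeasurableSpace E] [BorelSpace E]
    (V : Submodule ℝ E) (x : E) {ρ w : ℝ} (hρ : 0 ≤ ρ) (hw : 0 ≤ w)
    (hbal : w ^ 2 / (finrank ℝ Vᗮ + 2) ≤ ρ ^ 2 / (finrank ℝ V + 2))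
    (L : AffineSubspace ℝ E) (hL : (L : Set E).Nonempty)
    (hVL : finrank ℝ L.direction = finrank ℝ V) :
    finrank ℝ Vᗮ * (w ^ 2 / (finrank ℝ Vᗮ + 2)) * volume.real (orthoCylinder V x ρ w) ≤
      ∫ y in orthoCylinder V x ρ w, infDist y (L : Set E) ^ 2 := by
  obtain ⟨p, hp⟩ := hL
  set b := stdOrthonormalBasis ℝ L.directionᗮ
  have hrank : finrank ℝ L.directionᗮ = finrank ℝ Vᗮ := by
    have h1 := V.finrank_add_finrank_orthogonal
    have h2 := L.direction.finrank_add_finrank_orthogonal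
    omega
  have hcompact := isCompact_orthoCylinder V x ρ w
  simp_rw [L.infDist_sq_eq_sum_inner_sq hp b]
  rw [integral_finsetSum _ fun i _ => (by fun_prop :
    Continuous fun y => ⟪(b i : E), y - p⟫ ^ 2).continuousOn.integrableOn_compact hcompact]
  simp_rw [setIntegral_orthoCylinder_inner_sub_sq V x p _ hρ hw, ← Finset.sum_mul]
  gcongr
  calc finrank ℝ Vᗮ * (w ^ 2 / (finrank ℝ Vᗮ + 2))
      = ∑ i : Fin (finrank ℝ L.directionᗮ), w ^ 2 / (finrank ℝ Vᗮ + 2 : ℝ) := by simp [hrank]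
    _ ≤ _ := by
      refine Finset.sum_le_sum fun i _ => ?_
      have h1 : ‖V.orthogonalProjectionOnto (b i : E)‖ ^ 2 +
          ‖Vᗮ.orthogonalProjectionOnto (b i : E)‖ ^ 2 = 1 := by
        rw [← V.norm_sq_eq_add_norm_sq_projection, ← Submodule.coe_norm, b.norm_eq_one, one_pow]
      have h2 := mul_le_mul_of_nonneg_left hbal
        (sq_nonneg ‖V.orthogonalProjectionOnto (b i : E)‖)
      rw [← eq_sub_iff_add_eq'] at h1
      rw [h1, sub_mul, one_mul]
      linarith [sq_nonneg ⟪(b i : E), x - p⟫]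

end Flat

section Tube

variable {E : Type*} [NormedAddCommGroup E] [InnerProductSpace ℝ E] [FiniteDimensional ℝ E]

theorem orthoCylinder_subset_tube_inter_closedBall [MeasurableSpace E] [BorelSpace E]
    (L : AffineSubspace ℝ E) {x : E} (hx : x ∈ L) {ρ w r : ℝ} (hr : 0 ≤ r)
    (h : ρ ^ 2 + w ^ 2 ≤ r ^ 2) :
    orthoCylinder L.direction x ρ w ⊆ tube (L : Set E) w ∩ closedBall x r := by
  intro y hy
  obtain ⟨h1, h2⟩ := mem_orthoCylinder.1 hy
  refine ⟨(L.infDist_eq_norm_orthogonalProjectionOnto hx y).trans_le h2, ?_⟩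
  rw [mem_closedBall, dist_eq_norm, ← sq_le_sq₀ (norm_nonneg _) hr,
    L.direction.norm_sq_eq_add_norm_sq_projection]
  refine le_trans ?_ h
  gcongr

theorem tube_inter_closedBall_subset_orthoCylinder [MeasurableSpace E] [BorelSpace E]
    (L : AffineSubspace ℝ E) {x : E} (hx : x ∈ L) (w r : ℝ) :
    tube (L : Set E) w ∩ closedBall x r ⊆ orthoCylinder L.direction x r w := by
  rintro y ⟨h1, h2⟩
  refine mem_orthoCylinder.2 ⟨?_,
    (L.infDist_eq_norm_orthogonalProjectionOnto hx y).symm.trans_le h1⟩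
  rw [mem_closedBall, dist_eq_norm] at h2
  exact (L.direction.norm_orthogonalProjectionOnto_apply_le _).trans h2

theorem isCompact_tube_inter_closedBall (L : Set E) (w : ℝ) (x : E) (r : ℝ) :
    IsCompact (tube L w ∩ closedBall x r) :=
  (isCompact_closedBall x r).inter_left
    (isClosed_le (continuous_infDist_pt L) continuous_const)

/-- The mean square distance to any `d`-flat over the part of a tube of axis `L₁` in a ball. -/
theorem le_average_tube_infDist_sq [MeasurableSpace E] [BorelSpace E]
    (L₁ : AffineSubspace ℝ E) {x : E} (hx : x ∈ L₁) {w r : ℝ} (hw : 0 < w) (hwr : w < r)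
    (hbal : w ^ 2 * (finrank ℝ L₁.direction + 2) ≤
      (r ^ 2 - w ^ 2) * (finrank ℝ L₁.directionᗮ + 2))
    (L : AffineSubspace ℝ E) (hL : (L : Set E).Nonempty)
    (hLL₁ : finrank ℝ L.direction = finrank ℝ L₁.direction) :
    finrank ℝ L₁.directionᗮ / (finrank ℝ L₁.directionᗮ + 2) * w ^ 2 *
        (1 - w ^ 2 / r ^ 2) ^ ((finrank ℝ L₁.direction : ℝ) / 2) ≤
      (volume.real (tube (L₁ : Set E) w ∩ closedBall x r))⁻¹ *
        ∫ y in tube (L₁ : Set E) w ∩ closedBall x r, infDist y (L : Set E) ^ 2 := by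
  have hr : 0 < r := hw.trans hwr
  have hρ2 : 0 < r ^ 2 - w ^ 2 := by nlinarith
  set ρ := √(r ^ 2 - w ^ 2)
  have hρ : 0 < ρ := Real.sqrt_pos.2 hρ2
  have hρsq : ρ ^ 2 = r ^ 2 - w ^ 2 := Real.sq_sqrt hρ2.le
  set V := L₁.direction
  set K := tube (L₁ : Set E) w ∩ closedBall x r
  set d := finrank ℝ V
  set k := finrank ℝ Vᗮ
  have hK : IsCompact K := isCompact_tube_inter_closedBall _ _ _ _
  have hsub : orthoCylinder V x ρ w ⊆ K :=
    orthoCylinder_subset_tube_inter_closedBall L₁ hx hr.le (by rw [hρsq]; linarith)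
  have hsup : K ⊆ orthoCylinder V x r w :=
    tube_inter_closedBall_subset_orthoCylinder L₁ hx w r
  have hball : 0 < volume.real (ball (0 : V) 1) * volume.real (closedBall (0 : Vᗮ) w) :=
    mul_pos (ENNReal.toReal_pos (measure_ball_pos _ _ one_pos).ne' measure_ball_lt_top.ne)
      (ENNReal.toReal_pos (measure_closedBall_pos _ _ hw).ne' measure_closedBall_lt_top.ne)
  have hvol : ∀ {t : ℝ}, 0 ≤ t → volume.real (orthoCylinder V x t w) =
      t ^ d * (volume.real (ball (0 : V) 1) * volume.real (closedBall (0 : Vᗮ) w)) := by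
    intro t ht
    rw [volume_real_orthoCylinder, volume_real_closedBall_zero ht, mul_assoc]
  have hratio : (1 - w ^ 2 / r ^ 2) ^ ((d : ℝ) / 2) = ρ ^ d / r ^ d := by
    have : 1 - w ^ 2 / r ^ 2 = (ρ / r) ^ 2 := by
      rw [div_pow, hρsq]
      field_simp
    rw [this, ← div_pow, ← Real.rpow_natCast (ρ / r) 2, ← Real.rpow_mul (by positivity),
      ← Real.rpow_natCast _ d]
    congr 1
    push_cast
    ring
  have hKpos : 0 < volume.real K := lt_of_lt_of_le
    (by rw [hvol hρ.le]; positivity) (measureReal_mono hsub hK.measure_lt_top.ne)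
  have hKle : volume.real K ≤
      r ^ d * (volume.real (ball (0 : V) 1) * volume.real (closedBall (0 : Vᗮ) w)) :=
    hvol hr.le ▸ measureReal_mono hsup (isCompact_orthoCylinder V x r w).measure_lt_top.ne
  have hint := le_setIntegral_orthoCylinder_infDist_sq V x hρ.le hw.le
    (by rw [hρsq, div_le_div_iff₀ (by positivity) (by positivity)]; exact hbal) L hL hLL₁
  have hmono : ∫ y in orthoCylinder V x ρ w, infDist y (L : Set E) ^ 2 ≤
      ∫ y in K, infDist y (L : Set E) ^ 2 :=
    setIntegral_mono_set
      (((continuous_infDist_pt (L : Set E)).pow 2).continuousOn.integrableOn_compact hK)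
      (Filter.Eventually.of_forall fun y => sq_nonneg _) (LE.le.eventuallyLE hsub)
  rw [hratio, inv_mul_eq_div, le_div_iff₀ hKpos]
  refine le_trans ?_ (hint.trans hmono)
  rw [hvol hρ.le]
  calc _ ≤ k / (k + 2) * w ^ 2 * (ρ ^ d / r ^ d) * (r ^ d *
        (volume.real (ball (0 : V) 1) * volume.real (closedBall (0 : Vᗮ) w))) := by gcongr
    _ = k * (w ^ 2 / (k + 2)) * (ρ ^ d *
        (volume.real (ball (0 : V) 1) * volume.real (closedBall (0 : Vᗮ) w))) := by field_simp

end Tube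

/-- If inside `B(x,r)`, with `x ∈ L₁`, `0 < w < r` and `(r² − w²)(D−d+2) ≥ w²(d+2)`, the set
`Ω` coincides with the tube `T(L₁,w)`, then
`β₂(x,r)² ≥ ((D−d)/(D−d+2)) · (w²/(4r²)) · (1 − w²/r²)^{d/2}`. -/
theorem beta2Sq_lower_bound (d D : ℕ) (hd : 0 < d) (hdD : d < D)
    (L₁ : AffineSubspace ℝ (EuclideanSpace ℝ (Fin D)))
    (hL₁d : Module.finrank ℝ L₁.direction = d)
    (x : EuclideanSpace ℝ (Fin D)) (hx : x ∈ L₁)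
    (w r : ℝ) (hw : 0 < w) (hwr : w < r)
    (hbal : w ^ 2 * ((d : ℝ) + 2) ≤ (r ^ 2 - w ^ 2) * (((D - d : ℕ) : ℝ) + 2))
    (Ω : Set (EuclideanSpace ℝ (Fin D))) (hΩmeas : MeasurableSet Ω)
    (hΩ : Ω ∩ closedBall x r =
      tube (L₁ : Set (EuclideanSpace ℝ (Fin D))) w ∩ closedBall x r) :
    beta2Sq d D Ω x r ≥
      (((D - d : ℕ) : ℝ) / (((D - d : ℕ) : ℝ) + 2)) * (w ^ 2 / (4 * r ^ 2)) *
        (1 - w ^ 2 / r ^ 2) ^ ((d : ℝ) / 2) := by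
  have hcodim : finrank ℝ L₁.directionᗮ = D - d := by
    have := L₁.direction.finrank_add_finrank_orthogonal
    rw [finrank_euclideanSpace_fin] at this
    omega
  refine le_csInf ⟨_, L₁, hL₁d, ⟨x, hx⟩, rfl⟩ ?_
  rintro s ⟨L, hLd, hL, rfl⟩
  have h := le_average_tube_infDist_sq L₁ hx hw hwr (by rwa [hL₁d, hcodim]) L hL
    (hLd.trans hL₁d.symm)
  rw [hL₁d, hcodim] at h
  rw [hΩ]
  simp_rw [div_pow]
  rw [integral_div, ← mul_div_assoc (_⁻¹ : ℝ), le_div_iff₀ (by have := hw.trans hwr; positivity)]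
  refine le_of_eq_of_le ?_ h
  have : r ≠ 0 := (hw.trans hwr).ne'
  field_simp
  ring
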